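/- arXiv:1904.07196 — 2 statements merged into one kernel-verified Lean document; each statement's English description precedes it below -/
import Mathlib

section
/- Let I be a nonempty open real interval, let f, g: I → ℝ be continuous strictly monotone functions, let p = (p_1,…,p_n): I → ℝ_+^n be continuous on I, and let q = (q_1,…,q_n): I → ℝ_+^n. Assume there exists an open set U ⊆ I^n containing the diagonal diag(I^n) such that A_{f,p} = A_{g,q} on U, and that there exist a, b, c, d ∈ ℝ with ad ≠ bc and a nonempty open subinterval J of I such that cf + d > 0, g = (af + b)/(cf + d), and q_i = (cf + d)·p_i for all i ∈ {1,…,n} hold on J. Then q is continuous on I and these three relations hold on all of I. -/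
open Set Filter Topology

/-- An injective continuous function attains every proper convex combination of two values strictly
between their arguments. -/
lemma exists_mem_openSegment_of_weighted_mean {I : Set ℝ} (hI : I.OrdConnected) {f : ℝ → ℝ}
    (hfc : ContinuousOn f I) (hinj : InjOn f I) {x u : ℝ} (hx : x ∈ I) (hu : u ∈ I) (hxu : x ≠ u)
    {s t : ℝ} (hs : 0 < s) (ht : 0 < t) :
    ∃ m ∈ openSegment ℝ x u, f m = (s * f x + t * f u) / (s + t) := by
  have hst : s + t ≠ 0 := by positivity
  have hne : f x ≠ f u := fun h => hxu (hinj hx hu h)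
  have hv : (s * f x + t * f u) / (s + t) ∈ uIcc (f x) (f u) := by
    rw [← segment_eq_uIcc]
    refine ⟨s / (s + t), t / (s + t), by positivity, by positivity, by field_simp, ?_⟩
    simp only [smul_eq_mul]
    field_simp
  obtain ⟨m, hm, hfm⟩ := intermediate_value_uIcc (hfc.mono (hI.uIcc_subset hx hu)) hv
  refine ⟨m, ?_, hfm⟩
  rw [eq_div_iff hst] at hfm
  refine mem_openSegment_of_ne_left_right ?_ ?_ (segment_eq_uIcc x u ▸ hm)
  · rintro rfl
    exact hne (mul_left_cancel₀ ht.ne' (by linarith))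
  · rintro rfl
    exact hne (mul_left_cancel₀ hs.ne' (by linarith))

/-- The image of an open set under a continuous strictly monotone function is a neighbourhood of
each of its points. -/
lemma image_mem_nhds_of_strictMonoOn_or_strictAntiOn {T : Set ℝ} (hT : IsOpen T) {f : ℝ → ℝ}
    (hfc : ContinuousOn f T) (hf : StrictMonoOn f T ∨ StrictAntiOn f T) {m : ℝ} (hm : m ∈ T) :
    f '' T ∈ 𝓝 (f m) := by
  obtain ⟨ε, hε, hball⟩ := Metric.isOpen_iff.1 hT m hm
  have hsub : Icc (m - ε / 2) (m + ε / 2) ⊆ T := by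
    intro z hz
    apply hball
    rw [Metric.mem_ball, Real.dist_eq, abs_lt]
    constructor <;> linarith [hz.1, hz.2]
  have hle : m - ε / 2 ≤ m + ε / 2 := by linarith
  have hl := hsub (left_mem_Icc.2 hle)
  have hr := hsub (right_mem_Icc.2 hle)
  rcases hf with hf | hf
  · refine mem_of_superset (Ioo_mem_nhds (hf hl hm (by linarith)) (hf hm hr (by linarith))) ?_
    exact (Ioo_subset_Icc_self.trans (intermediate_value_Icc hle (hfc.mono hsub))).trans
      (image_mono hsub)
  · refine mem_of_superset (Ioo_mem_nhds (hf hm hr (by linarith)) (hf hl hm (by linarith))) ?_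
    exact (Ioo_subset_Icc_self.trans (intermediate_value_Icc' hle (hfc.mono hsub))).trans
      (image_mono hsub)

/-- A left inverse of `f` on an interval, for `f` continuous, is also a right inverse on the convex
hull of the range. -/
lemma apply_leftInverse_of_mem_convexHull {I : Set ℝ} (hI : I.OrdConnected) {f finv : ℝ → ℝ}
    (hfc : ContinuousOn f I) (hleft : ∀ x ∈ I, finv (f x) = x) {v : ℝ}
    (hv : v ∈ convexHull ℝ (f '' I)) : f (finv v) = v := by
  rw [(hI.isPreconnected.image f hfc).ordConnected.convex.convexHull_eq] at hv
  obtain ⟨z, hz, rfl⟩ := hv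
  rw [hleft z hz]

lemma weighted_mean_mem_convexHull_image {I : Set ℝ} {f : ℝ → ℝ} {x u : ℝ} (hx : x ∈ I)
    (hu : u ∈ I) {s t : ℝ} (hs : 0 < s) (ht : 0 < t) :
    (s * f x + t * f u) / (s + t) ∈ convexHull ℝ (f '' I) := by
  refine segment_subset_convexHull (mem_image_of_mem f hx) (mem_image_of_mem f hu)
    ⟨s / (s + t), t / (s + t), by positivity, by positivity, by field_simp, ?_⟩
  simp only [smul_eq_mul]
  field_simp

lemma sum_update_const {n : ℕ} (i : Fin n) (h : Fin n → ℝ → ℝ) (x u : ℝ) :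
    ∑ j, h j (Function.update (Function.const (Fin n) u) i x j) =
      h i x + ∑ j ∈ Finset.univ.erase i, h j u := by
  rw [← Finset.add_sum_erase _ _ (Finset.mem_univ i)]
  congr 1
  · simp
  · refine Finset.sum_congr rfl fun j hj => ?_
    simp [Function.update_of_ne (Finset.ne_of_mem_erase hj)]

/-- If the weighted mean of `x` and `u` transforms under `t ↦ (a t + b) / (c t + d)` and so does
the point `u`, then the deviation of `x` from the transformation rule satisfies a linear equation
in the mean value. -/
lemma deviation_linear_eq {a b c d s S t T x y u v F G : ℝ} (hs : s + S ≠ 0) (ht : t + T ≠ 0)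
    (hu : 0 < c * u + d) (hF : 0 < c * F + d) (hT : T = (c * u + d) * S)
    (hv : v = (a * u + b) / (c * u + d)) (hG : G = (a * F + b) / (c * F + d))
    (hmF : (s * x + S * u) / (s + S) = F) (hmG : (t * y + T * v) / (t + T) = G) :
    (t * y - s * (a * x + b)) * (c * F + d) = (t - s * (c * x + d)) * (a * F + b) := by
  rw [div_eq_iff hs] at hmF
  rw [div_eq_iff ht] at hmG
  rw [eq_div_iff hF.ne'] at hG
  rw [eq_div_iff hu.ne'] at hv
  have hTv : T * v = S * (a * u + b) := by rw [hT, ← hv]; ring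
  have key : (t * y + S * (a * u + b)) * (c * F + d) = (a * F + b) * (t + T) := by
    rw [← hTv, hmG, ← hG]; ring
  rw [hT] at key
  linear_combination key + (c * (a * F + b) - a * (c * F + d)) * hmF

lemma eq_zero_and_eq_zero_of_linear_eqs {a b c d X Y F₀ F₁ : ℝ} (h : a * d ≠ b * c)
    (hF : F₀ ≠ F₁) (h₀ : X * (c * F₀ + d) = Y * (a * F₀ + b))
    (h₁ : X * (c * F₁ + d) = Y * (a * F₁ + b)) : X = 0 ∧ Y = 0 := by
  have hmul : (X * c - Y * a) * (F₀ - F₁) = 0 := by linear_combination h₀ - h₁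
  have hlin : X * c - Y * a = 0 := (mul_eq_zero.1 hmul).resolve_right (sub_ne_zero.2 hF)
  have hcst : X * d - Y * b = 0 := by linear_combination h₀ - F₀ * hlin
  have hdet := sub_ne_zero.2 h
  exact ⟨(mul_eq_zero.1 (show X * (a * d - b * c) = 0 by
      linear_combination a * hcst - b * hlin)).resolve_right hdet,
    (mul_eq_zero.1 (show Y * (a * d - b * c) = 0 by
      linear_combination c * hcst - d * hlin)).resolve_right hdet⟩

/-- The canonical relations between the generators `(f, p)` and `(g, q)` at the point `x`. -/
def CanonicalRelations {n : ℕ} (f g : ℝ → ℝ) (p q : Fin n → ℝ → ℝ) (a b c d x : ℝ) : Prop :=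
  0 < c * f x + d ∧ g x = (a * f x + b) / (c * f x + d) ∧ ∀ i, q i x = (c * f x + d) * p i x

/-- If a property holds on a nonempty open subinterval of an open interval `I`, and whenever it holds
on an open subinterval it holds near each limit point of that subinterval in `I`, then it holds on
all of `I`. -/
lemma forall_mem_of_eventually_of_mem_closure {I J : Set ℝ} (hI : IsPreconnected I) {R : ℝ → Prop}
    (hJo : IsOpen J) (hJne : J.Nonempty) (hJc : J.OrdConnected) (hJI : J ⊆ I) (hJR : ∀ x ∈ J, R x)
    (hIo : IsOpen I)
    (hext : ∀ T : Set ℝ, IsOpen T → T.OrdConnected → T ⊆ I → (∀ x ∈ T, R x) →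
      ∀ β ∈ I, β ∈ closure T → ∀ᶠ x in 𝓝 β, R x) :
    ∀ x ∈ I, R x := by
  obtain ⟨x₀, hx₀⟩ := hJne
  set C : Set (Set ℝ) := {K | IsOpen K ∧ IsPreconnected K ∧ K ⊆ I ∧ x₀ ∈ K ∧ ∀ x ∈ K, R x}
  have hJC : J ∈ C := ⟨hJo, hJc.isPreconnected, hJI, hx₀, hJR⟩
  have hTo : IsOpen (⋃₀ C) := isOpen_sUnion fun K hK => hK.1
  have hTc : IsPreconnected (⋃₀ C) :=
    isPreconnected_sUnion x₀ C (fun K hK => hK.2.2.2.1) fun K hK => hK.2.1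
  have hTI : ⋃₀ C ⊆ I := sUnion_subset fun K hK => hK.2.2.1
  have hTR : ∀ x ∈ ⋃₀ C, R x := fun x ⟨K, hK, hx⟩ => hK.2.2.2.2 x hx
  have hx₀T : x₀ ∈ ⋃₀ C := ⟨J, hJC, hx₀⟩
  suffices h : I ⊆ ⋃₀ C from fun x hx => hTR x (h hx)
  refine hI.subset_of_closure_inter_subset hTo ⟨x₀, hJI hx₀, hx₀T⟩ ?_
  rintro β ⟨hβcl, hβI⟩
  have hev := (hext _ hTo hTc.ordConnected hTI hTR β hβI hβcl).and (hIo.mem_nhds hβI)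
  obtain ⟨ε, hε, hball⟩ := Metric.eventually_nhds_iff_ball.1 hev
  obtain ⟨z, hzT, hz⟩ := Metric.mem_closure_iff.1 hβcl ε hε
  refine ⟨⋃₀ C ∪ Metric.ball β ε, ⟨hTo.union Metric.isOpen_ball, ?_, ?_, Or.inl hx₀T, ?_⟩,
    Or.inr (Metric.mem_ball_self hε)⟩
  · exact hTc.union z hzT (by rwa [Metric.mem_ball, dist_comm])
      (convex_ball β ε).isPreconnected
  · exact union_subset hTI fun x hx => (hball x hx).2
  · rintro x (hx | hx)
    · exact hTR x hx
    · exact (hball x hx).1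

/-- If two generalized Bajraktarević means coincide near the diagonal and the canonical relations
hold on an open interval, then they hold near each limit point of that interval. -/
lemma eventually_canonicalRelations {I : Set ℝ} (hIopen : IsOpen I) (hI : I.OrdConnected)
    {n : ℕ} (hn : 2 ≤ n) {f g finvf finvg : ℝ → ℝ} (hfc : ContinuousOn f I)
    (hgc : ContinuousOn g I) (hf : StrictMonoOn f I ∨ StrictAntiOn f I)
    (hfleft : ∀ x ∈ I, finvf (f x) = x) (hgleft : ∀ x ∈ I, finvg (g x) = x)
    {p q : Fin n → ℝ → ℝ} (hpc : ∀ i, ContinuousOn (p i) I)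
    (hp : ∀ i, ∀ x ∈ I, 0 < p i x) (hq : ∀ i, ∀ x ∈ I, 0 < q i x)
    {U : Set (Fin n → ℝ)} (hUopen : IsOpen U) (hUdiag : ∀ x ∈ I, Function.const (Fin n) x ∈ U)
    (heq : ∀ y ∈ U,
      finvf ((∑ i, p i (y i) * f (y i)) / (∑ i, p i (y i))) =
      finvg ((∑ i, q i (y i) * g (y i)) / (∑ i, q i (y i))))
    {a b c d : ℝ} (habcd : a * d ≠ b * c) {T : Set ℝ} (hTo : IsOpen T) (hTc : T.OrdConnected)
    (hTI : T ⊆ I) (hTR : ∀ x ∈ T, CanonicalRelations f g p q a b c d x) {β : ℝ} (hβI : β ∈ I)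
    (hβcl : β ∈ closure T) : ∀ᶠ x in 𝓝 β, CanonicalRelations f g p q a b c d x := by
  by_cases hβT : β ∈ T
  · exact Filter.mem_of_superset (hTo.mem_nhds hβT) hTR
  have hinj : InjOn f I := hf.elim (fun h => h.injOn) fun h => h.injOn
  obtain ⟨ε, hε, hball⟩ := Metric.isOpen_iff.1 hUopen _ (hUdiag β hβI)
  have hmemU : ∀ (i : Fin n) (x u : ℝ), dist x β < ε → dist u β < ε →
      Function.update (Function.const (Fin n) u) i x ∈ U := by
    intro i x u hx hu
    apply hball
    rw [Metric.mem_ball, dist_pi_lt_iff hε]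
    intro j
    by_cases hj : j = i
    · subst hj; simpa using hx
    · simpa [Function.update_of_ne hj] using hu
  have hseg : ∀ u ∈ T, openSegment ℝ β u ⊆ T := by
    intro u hu
    have h := (hTc.convex (𝕜 := ℝ)).openSegment_closure_interior_subset_interior hβcl
      (hTo.interior_eq.symm ▸ hu)
    rwa [hTo.interior_eq] at h
  set P : Fin n → ℝ → ℝ := fun i u => ∑ j ∈ Finset.univ.erase i, p j u with hP
  set Q : Fin n → ℝ → ℝ := fun i u => ∑ j ∈ Finset.univ.erase i, q j u with hQ
  have hne : ∀ i : Fin n, (Finset.univ.erase i).Nonempty := by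
    intro i
    rw [← Finset.card_pos, Finset.card_erase_of_mem (Finset.mem_univ i), Finset.card_univ,
      Fintype.card_fin]
    omega
  have hPpos : ∀ i, ∀ u ∈ I, 0 < P i u := fun i u hu =>
    Finset.sum_pos (fun j _ => hp j u hu) (hne i)
  have hQpos : ∀ i, ∀ u ∈ I, 0 < Q i u := fun i u hu =>
    Finset.sum_pos (fun j _ => hq j u hu) (hne i)
  set F : Fin n → ℝ → ℝ → ℝ := fun i x u => (p i x * f x + P i u * f u) / (p i x + P i u)
  have hFlin : ∀ i, ∀ x ∈ I, ∀ u ∈ T, dist x β < ε → dist u β < ε → F i x u ∈ f '' T →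
      (q i x * g x - p i x * (a * f x + b)) * (c * F i x u + d) =
        (q i x - p i x * (c * f x + d)) * (a * F i x u + b) := by
    rintro i x hx u hu hxε huε ⟨m, hm, hfm⟩
    have huI := hTI hu
    obtain ⟨hu1, hu2, hu3⟩ := hTR u hu
    obtain ⟨hm1, hm2, -⟩ := hTR m hm
    have h := heq _ (hmemU i x u hxε huε)
    rw [sum_update_const i (fun j z => p j z * f z), sum_update_const i (fun j z => p j z),
      sum_update_const i (fun j z => q j z * g z), sum_update_const i (fun j z => q j z),
      ← Finset.sum_mul, ← Finset.sum_mul] at h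
    change finvf (F i x u) = finvg ((q i x * g x + Q i u * g u) / (q i x + Q i u)) at h
    rw [← hfm, hfleft m (hTI hm)] at h
    have hG : (q i x * g x + Q i u * g u) / (q i x + Q i u) = g m := by
      rw [h, apply_leftInverse_of_mem_convexHull hI hgc hgleft
        (weighted_mean_mem_convexHull_image hx huI (hq i x hx) (hQpos i u huI))]
    rw [← hfm]
    refine deviation_linear_eq (add_pos (hp i x hx) (hPpos i u huI)).ne'
      (add_pos (hq i x hx) (hQpos i u huI)).ne' hu1 hm1 ?_ hu2 hm2 hfm.symm hG
    simp only [hP, hQ, Finset.mul_sum]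
    exact Finset.sum_congr rfl fun j _ => hu3 j
  have hFcont : ∀ i, ∀ u ∈ I, ContinuousAt (fun x => F i x u) β := by
    intro i u hu
    have h1 := (hpc i).continuousAt (hIopen.mem_nhds hβI)
    have h2 := hfc.continuousAt (hIopen.mem_nhds hβI)
    exact ((h1.mul h2).add continuousAt_const).div (h1.add continuousAt_const)
      (add_pos (hp i β hβI) (hPpos i u hu)).ne'
  have hmean : ∀ i, ∀ u ∈ T, ∃ m ∈ openSegment ℝ β u, f m = F i β u := fun i u hu =>
    exists_mem_openSegment_of_weighted_mean hI hfc hinj hβI (hTI hu)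
      (fun h => hβT (h ▸ hu)) (hp i β hβI) (hPpos i u (hTI hu))
  have himage : ∀ m ∈ T, f '' T ∈ 𝓝 (f m) := fun m hm =>
    image_mem_nhds_of_strictMonoOn_or_strictAntiOn hTo (hfc.mono hTI)
      (hf.imp (fun h => h.mono hTI) fun h => h.mono hTI) hm
  obtain ⟨u₀, hu₀, hu₀ε⟩ := Metric.mem_closure_iff.1 hβcl ε hε
  rw [dist_comm] at hu₀ε
  have hev : ∀ i, ∀ᶠ x in 𝓝 β,
      q i x * g x - p i x * (a * f x + b) = 0 ∧ q i x - p i x * (c * f x + d) = 0 := by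
    intro i
    obtain ⟨m₀, hm₀s, hm₀⟩ := hmean i u₀ hu₀
    have hm₀T := hseg u₀ hu₀ hm₀s
    obtain ⟨m₁, hm₁s, hm₁⟩ := hmean i m₀ hm₀T
    have hm₁T := hseg m₀ hm₀T hm₁s
    have hm₀ε : dist m₀ β < ε :=
      (convex_ball β ε).openSegment_subset (Metric.mem_ball_self hε) hu₀ε hm₀s
    have hm₀₁ : m₀ ≠ m₁ := by
      rintro rfl
      exact hβT ((right_mem_openSegment_iff.1 hm₁s) ▸ hm₀T)
    have hFne : F i β u₀ ≠ F i β m₀ := by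
      rw [← hm₀, ← hm₁]
      exact fun h => hm₀₁ (hinj (hTI hm₀T) (hTI hm₁T) h)
    have hc₀ := hFcont i u₀ (hTI hu₀)
    have hc₁ := hFcont i m₀ (hTI hm₀T)
    filter_upwards [hIopen.mem_nhds hβI, Metric.ball_mem_nhds β hε,
      hc₀.eventually_mem (hm₀ ▸ himage m₀ hm₀T), hc₁.eventually_mem (hm₁ ▸ himage m₁ hm₁T),
      (hc₀.sub hc₁).eventually_ne (sub_ne_zero.2 hFne)] with x hxI hxε h₀ h₁ hne'
    exact eq_zero_and_eq_zero_of_linear_eqs habcd (sub_ne_zero.1 hne')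
      (hFlin i x hxI u₀ hu₀ hxε hu₀ε h₀) (hFlin i x hxI m₀ hm₀T hxε hm₀ε h₁)
  filter_upwards [hIopen.mem_nhds hβI, eventually_all.2 hev] with x hxI hx
  have i₀ : Fin n := ⟨0, by omega⟩
  have hpx := hp i₀ x hxI
  have hqx := hq i₀ x hxI
  obtain ⟨hX, hY⟩ := hx i₀
  have hpos : 0 < c * f x + d := by
    rw [sub_eq_zero.1 hY] at hqx
    exact pos_of_mul_pos_right hqx hpx.le
  refine ⟨hpos, ?_, fun i => by linear_combination (hx i).2⟩
  rw [eq_div_iff hpos.ne']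
  refine mul_left_cancel₀ hpx.ne' ?_
  linear_combination hX - g x * hY


/-- Theorem BM4: if `A_{f,p} = A_{g,q}` on an open set `U ⊆ Iⁿ` containing the
diagonal and the canonical relations hold on some nonempty open subinterval `J`
of `I`, then `q` is continuous on `I` and the canonical relations hold on all
of `I`. -/
theorem stmt_9 (I : Set ℝ) (hIopen : IsOpen I) (hIne : I.Nonempty)
    (hIconn : I.OrdConnected) (n : ℕ) (hn : 2 ≤ n) (f g : ℝ → ℝ)
    (hfc : ContinuousOn f I) (hgc : ContinuousOn g I)
    (hf : StrictMonoOn f I ∨ StrictAntiOn f I)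
    (hg : StrictMonoOn g I ∨ StrictAntiOn g I)
    (finvf : ℝ → ℝ)
    (hfmaps : Set.MapsTo finvf (convexHull ℝ (f '' I)) I)
    (hfmono : MonotoneOn finvf (convexHull ℝ (f '' I)) ∨
      AntitoneOn finvf (convexHull ℝ (f '' I)))
    (hfleft : ∀ x ∈ I, finvf (f x) = x)
    (finvg : ℝ → ℝ)
    (hgmaps : Set.MapsTo finvg (convexHull ℝ (g '' I)) I)
    (hgmono : MonotoneOn finvg (convexHull ℝ (g '' I)) ∨
      AntitoneOn finvg (convexHull ℝ (g '' I)))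
    (hgleft : ∀ x ∈ I, finvg (g x) = x)
    (p q : Fin n → ℝ → ℝ)
    (hpc : ∀ i, ContinuousOn (p i) I)
    (hp : ∀ i, ∀ x ∈ I, 0 < p i x) (hq : ∀ i, ∀ x ∈ I, 0 < q i x)
    (U : Set (Fin n → ℝ)) (hUopen : IsOpen U)
    (hUsub : U ⊆ {y : Fin n → ℝ | ∀ i, y i ∈ I})
    (hUdiag : ∀ x ∈ I, Function.const (Fin n) x ∈ U)
    (heq : ∀ y ∈ U,
      finvf ((∑ i, p i (y i) * f (y i)) / (∑ i, p i (y i))) =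
      finvg ((∑ i, q i (y i) * g (y i)) / (∑ i, q i (y i))))
    (a b c d : ℝ) (habcd : a * d ≠ b * c)
    (J : Set ℝ) (hJopen : IsOpen J) (hJne : J.Nonempty)
    (hJconn : J.OrdConnected) (hJsub : J ⊆ I)
    (hposJ : ∀ x ∈ J, 0 < c * f x + d)
    (hgfJ : ∀ x ∈ J, g x = (a * f x + b) / (c * f x + d))
    (hqpJ : ∀ i, ∀ x ∈ J, q i x = (c * f x + d) * p i x) :
    (∀ i, ContinuousOn (q i) I) ∧
    (∀ x ∈ I, 0 < c * f x + d) ∧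
    (∀ x ∈ I, g x = (a * f x + b) / (c * f x + d)) ∧
    (∀ i, ∀ x ∈ I, q i x = (c * f x + d) * p i x) := by
  have hrel : ∀ x ∈ I, CanonicalRelations f g p q a b c d x :=
    forall_mem_of_eventually_of_mem_closure hIconn.isPreconnected hJopen hJne hJconn hJsub
      (fun x hx => ⟨hposJ x hx, hgfJ x hx, fun i => hqpJ i x hx⟩) hIopen
      fun T hTo hTc hTI hTR β hβI hβcl =>
        eventually_canonicalRelations hIopen hIconn hn hfc hgc hf hfleft hgleft hpc hp hq hUopen
          hUdiag heq habcd hTo hTc hTI hTR hβI hβcl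
  refine ⟨fun i => ?_, fun x hx => (hrel x hx).1, fun x hx => (hrel x hx).2.1,
    fun i x hx => (hrel x hx).2.2 i⟩
  exact (((continuousOn_const.mul hfc).add continuousOn_const).mul (hpc i)).congr
    fun x hx => (hrel x hx).2.2 i
end

section
/- Let I be a nonempty open real interval, let f: I → ℝ be three times differentiable on I with nonvanishing first derivative, let p = (p_1,…,p_n): I → ℝ_+^n, and let i, j ∈ {1,…,n} with i ≠ j such that p_i is twice differentiable and p_j is differentiable on I. Then the third-order partial derivative ∂_i²∂_j A_{f,p} exists, and for all x ∈ I, ∂_i²∂_j A_{f,p}(x,…,x) = (2 p_i' p_j'(2p_i − p_0) + p_j(2(p_i')² − p_i'' p_0))(x)/p_0(x)³ + ((2 p_i' p_j + p_i p_j')(2p_i − p_0))(x)/p_0(x)³ · (f''(x)/f'(x)) + (p_i(x)p_j(x)/p_0(x)³)·((3p_i(x) − p_0(x))(f''(x)/f'(x))² − p_i(x)·f'''(x)/f'(x)), where p_0 = p_1 + … + p_n. -/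
/-- The `n`-variable generalized Bajraktarević mean built from `f`, its
generalized left inverse `finv`, and the weight functions `p`. -/
noncomputable def bmean {n : ℕ} (f finv : ℝ → ℝ) (p : Fin n → ℝ → ℝ)
    (x : Fin n → ℝ) : ℝ :=
  finv ((∑ i, p i (x i) * f (x i)) / ∑ i, p i (x i))

open Function Topology

/-- Partial derivative of a sum whose `l`-th term depends only on the `l`-th coordinate. -/
theorem hasDerivAt_sum_update {n : ℕ} (g : Fin n → ℝ → ℝ) (y : Fin n → ℝ) (k : Fin n) {d : ℝ}
    (h : HasDerivAt (g k) d (y k)) :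
    HasDerivAt (fun t => ∑ l, g l (update y k t l)) d (y k) := by
  have hl : ∀ l ∈ Finset.univ, HasDerivAt (fun t => g l (update y k t l))
      (if l = k then d else 0) (y k) := by
    intro l _
    by_cases hlk : l = k
    · subst hlk
      simpa using h
    · simpa [hlk, update_of_ne hlk] using hasDerivAt_const (y k) (g l (y l))
  simpa using HasDerivAt.fun_sum hl

/-- Partial derivative of the weighted arithmetic mean of the values `f (y l)`. -/
theorem hasDerivAt_weighted_mean_update {n : ℕ} (f : ℝ → ℝ) (p : Fin n → ℝ → ℝ) (y : Fin n → ℝ)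
    (k : Fin n) {a b : ℝ} (hf : HasDerivAt f a (y k)) (hp : HasDerivAt (p k) b (y k))
    (hD : ∑ l, p l (y l) ≠ 0) :
    HasDerivAt (fun t => (∑ l, p l (update y k t l) * f (update y k t l)) /
        ∑ l, p l (update y k t l))
      ((p k (y k) * a + b * (f (y k) - (∑ l, p l (y l) * f (y l)) / ∑ l, p l (y l))) /
        ∑ l, p l (y l)) (y k) := by
  have h1 := hasDerivAt_sum_update (fun l s => p l s * f s) y k (hp.mul hf)
  have h2 := hasDerivAt_sum_update p y k hp
  have h3 := h1.fun_div h2 (by simpa using hD)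
  simp only [update_eq_self] at h3
  refine h3.congr_deriv ?_
  field_simp
  ring

/-- A weighted arithmetic mean of values of a continuous function on an interval is a value of
that function. -/
theorem weighted_mean_mem_image {n : ℕ} [NeZero n] {I : Set ℝ} (hI : I.OrdConnected) {f : ℝ → ℝ}
    (hf : ContinuousOn f I) {p : Fin n → ℝ → ℝ} (hp : ∀ l, ∀ x ∈ I, 0 < p l x)
    {y : Fin n → ℝ} (hy : ∀ l, y l ∈ I) :
    (∑ l, p l (y l) * f (y l)) / ∑ l, p l (y l) ∈ f '' I := by
  have hconv : Convex ℝ (f '' I) :=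
    (hI.isPreconnected.image f hf).ordConnected.convex
  have h := hconv.centerMass_mem (t := Finset.univ) (w := fun l => p l (y l))
    (z := fun l => f (y l)) (fun l _ => (hp l _ (hy l)).le)
    (Finset.sum_pos (fun l _ => hp l _ (hy l)) Finset.univ_nonempty)
    (fun l _ => Set.mem_image_of_mem f (hy l))
  simpa [Finset.centerMass, div_eq_inv_mul] using h

/-- A left inverse on an open set of a differentiable function whose derivative is continuous and
nonvanishing is differentiable. -/
theorem hasDerivAt_left_inverse {I : Set ℝ} (hI : IsOpen I) {f g : ℝ → ℝ}
    (hfd : DifferentiableOn ℝ f I) (hfc : ContinuousOn (deriv f) I)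
    (hg : ∀ x ∈ I, g (f x) = x) {m : ℝ} (hm : m ∈ I) (hf' : deriv f m ≠ 0) :
    HasDerivAt g (deriv f m)⁻¹ (f m) := by
  have hmI : I ∈ 𝓝 m := hI.mem_nhds hm
  have hs : HasStrictDerivAt f (deriv f m) m :=
    hasStrictDerivAt_of_hasDerivAt_of_continuousAt
      (Filter.eventually_of_mem hmI fun x hx => (hfd.differentiableAt (hI.mem_nhds hx)).hasDerivAt)
      (hfc.continuousAt hmI)
  exact (hs.to_local_left_inverse hf' (Filter.eventually_of_mem hmI hg)).hasDerivAt

/-- Derivative of the common shape of a first partial derivative of a Bajraktarević mean with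
respect to another variable. -/
theorem hasDerivAt_div_mul_comp {U D G : ℝ → ℝ} {A B c v q g' t : ℝ} (hU : HasDerivAt U v t)
    (hD : HasDerivAt D q t) (hG : HasDerivAt G g' t) (hD0 : D t ≠ 0) (hG0 : G t ≠ 0) :
    HasDerivAt (fun s => (A + B * (c - U s)) / (D s * G s))
      (-(B * v) / (D t * G t) - (A + B * (c - U t)) *
        (q / (D t ^ 2 * G t) + g' / (D t * G t ^ 2))) t := by
  refine ((((hU.const_sub c).const_mul B).const_add A).fun_div (hD.fun_mul hG)
    (mul_ne_zero hD0 hG0)).congr_deriv ?_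
  field_simp

/-- Derivative of the common shape of a second mixed partial derivative of a Bajraktarević mean. -/
theorem hasDerivAt_second_mixed {U D G W Q K : ℝ → ℝ} {A B c v q g' w r k t : ℝ}
    (hU : HasDerivAt U v t) (hD : HasDerivAt D q t) (hG : HasDerivAt G g' t)
    (hW : HasDerivAt W w t) (hQ : HasDerivAt Q r t) (hK : HasDerivAt K k t)
    (hD0 : D t ≠ 0) (hG0 : G t ≠ 0) :
    HasDerivAt (fun s => -(B * W s) / (D s * G s) - (A + B * (c - U s)) *
        (Q s / (D s ^ 2 * G s) + K s / (D s * G s ^ 2)))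
      (-(B * w) / (D t * G t) + B * W t * (q / (D t ^ 2 * G t) + g' / (D t * G t ^ 2))
        + B * v * (Q t / (D t ^ 2 * G t) + K t / (D t * G t ^ 2))
        - (A + B * (c - U t)) *
          (r / (D t ^ 2 * G t) - 2 * Q t * q / (D t ^ 3 * G t) - Q t * g' / (D t ^ 2 * G t ^ 2)
            + k / (D t * G t ^ 2) - K t * q / (D t ^ 2 * G t ^ 2)
            - 2 * K t * g' / (D t * G t ^ 3))) t := by
  refine (((hW.const_mul B).fun_neg.fun_div (hD.fun_mul hG) (mul_ne_zero hD0 hG0)).fun_sub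
    ((((hU.const_sub c).const_mul B).const_add A).fun_mul
      ((hQ.fun_div ((hD.fun_pow 2).fun_mul hG) (mul_ne_zero (pow_ne_zero 2 hD0) hG0)).fun_add
        (hK.fun_div (hD.fun_mul (hG.fun_pow 2)) (mul_ne_zero hD0 (pow_ne_zero 2 hG0)))))).congr_deriv
      ?_
  push_cast
  field_simp
  ring

/-- Theorem DB (3b): if `f` is three times differentiable with nonvanishing
first derivative, `pᵢ` is twice differentiable and `pⱼ` is differentiable
(`i ≠ j`), then `∂ᵢ²∂ⱼ A_{f,p}` exists on `Iⁿ` and on the diagonal equals the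
stated expression. -/
theorem stmt_14 (I : Set ℝ) (hIopen : IsOpen I) (hIne : I.Nonempty)
    (hIconn : I.OrdConnected) (n : ℕ) (hn : 2 ≤ n) (f : ℝ → ℝ)
    (hfd : DifferentiableOn ℝ f I) (hfd2 : DifferentiableOn ℝ (deriv f) I)
    (hfd3 : DifferentiableOn ℝ (deriv (deriv f)) I)
    (hf' : ∀ x ∈ I, deriv f x ≠ 0)
    (hf : StrictMonoOn f I ∨ StrictAntiOn f I) (finv : ℝ → ℝ)
    (hmaps : Set.MapsTo finv (convexHull ℝ (f '' I)) I)
    (hmono : MonotoneOn finv (convexHull ℝ (f '' I)) ∨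
      AntitoneOn finv (convexHull ℝ (f '' I)))
    (hleft : ∀ x ∈ I, finv (f x) = x)
    (p : Fin n → ℝ → ℝ) (hp : ∀ l, ∀ x ∈ I, 0 < p l x)
    (i j : Fin n) (hij : i ≠ j)
    (hpi : DifferentiableOn ℝ (p i) I)
    (hpi2 : DifferentiableOn ℝ (deriv (p i)) I)
    (hpj : DifferentiableOn ℝ (p j) I) :
    ∃ P1 P2 P3 : (Fin n → ℝ) → ℝ,
      (∀ y : Fin n → ℝ, (∀ l, y l ∈ I) →
        HasDerivAt (fun t => bmean f finv p (Function.update y j t))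
          (P1 y) (y j)) ∧
      (∀ y : Fin n → ℝ, (∀ l, y l ∈ I) →
        HasDerivAt (fun t => P1 (Function.update y i t)) (P2 y) (y i)) ∧
      (∀ y : Fin n → ℝ, (∀ l, y l ∈ I) →
        HasDerivAt (fun t => P2 (Function.update y i t)) (P3 y) (y i)) ∧
      (∀ x ∈ I,
        P3 (Function.const (Fin n) x) =
          (2 * deriv (p i) x * deriv (p j) x * (2 * p i x - ∑ l, p l x)
            + p j x * (2 * (deriv (p i) x) ^ 2
              - deriv (deriv (p i)) x * ∑ l, p l x)) / (∑ l, p l x) ^ 3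
          + (2 * deriv (p i) x * p j x + p i x * deriv (p j) x)
              * (2 * p i x - ∑ l, p l x) / (∑ l, p l x) ^ 3
              * (deriv (deriv f) x / deriv f x)
          + p i x * p j x / (∑ l, p l x) ^ 3 *
              ((3 * p i x - ∑ l, p l x) * (deriv (deriv f) x / deriv f x) ^ 2
                - p i x * (deriv (deriv (deriv f)) x / deriv f x))) := by
  have : NeZero n := ⟨by omega⟩
  have hder : ∀ {g : ℝ → ℝ}, DifferentiableOn ℝ g I → ∀ x ∈ I, HasDerivAt g (deriv g x) x :=
    fun hg x hx => (hg.differentiableAt (hIopen.mem_nhds hx)).hasDerivAt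
  let D : (Fin n → ℝ) → ℝ := fun y => ∑ l, p l (y l)
  let U : (Fin n → ℝ) → ℝ := fun y => (∑ l, p l (y l) * f (y l)) / D y
  let M : (Fin n → ℝ) → ℝ := bmean f finv p
  let V : Fin n → (Fin n → ℝ) → ℝ := fun k y =>
    (p k (y k) * deriv f (y k) + deriv (p k) (y k) * (f (y k) - U y)) / D y
  have hD0 : ∀ y : Fin n → ℝ, (∀ l, y l ∈ I) → D y ≠ 0 := fun y hy =>
    (Finset.sum_pos (fun l _ => hp l _ (hy l)) Finset.univ_nonempty).ne'
  have hM : ∀ y : Fin n → ℝ, (∀ l, y l ∈ I) → M y ∈ I ∧ f (M y) = U y := by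
    intro y hy
    obtain ⟨m, hm, hmU⟩ := weighted_mean_mem_image hIconn hfd.continuousOn hp hy
    have hMm : M y = m := by
      change finv _ = m
      rw [← hmU, hleft m hm]
    exact ⟨hMm ▸ hm, hMm ▸ hmU⟩
  have hDd : ∀ k, DifferentiableOn ℝ (p k) I → ∀ y : Fin n → ℝ, (∀ l, y l ∈ I) →
      HasDerivAt (fun t => D (update y k t)) (deriv (p k) (y k)) (y k) :=
    fun k hk y hy => hasDerivAt_sum_update p y k (hder hk _ (hy k))
  have hUd : ∀ k, DifferentiableOn ℝ (p k) I → ∀ y : Fin n → ℝ, (∀ l, y l ∈ I) →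
      HasDerivAt (fun t => U (update y k t)) (V k y) (y k) :=
    fun k hk y hy => hasDerivAt_weighted_mean_update f p y k (hder hfd _ (hy k))
      (hder hk _ (hy k)) (hD0 y hy)
  have hMd : ∀ k, DifferentiableOn ℝ (p k) I → ∀ y : Fin n → ℝ, (∀ l, y l ∈ I) →
      HasDerivAt (fun t => M (update y k t)) ((deriv f (M y))⁻¹ * V k y) (y k) := by
    intro k hk y hy
    obtain ⟨hm, hmU⟩ := hM y hy
    have hinv := hasDerivAt_left_inverse hIopen hfd hfd2.continuousOn hleft hm (hf' _ hm)
    exact HasDerivAt.comp (y k) (by simpa [hmU] using hinv) (hUd k hk y hy)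
  have hGd : ∀ {g : ℝ → ℝ}, DifferentiableOn ℝ g I → ∀ y : Fin n → ℝ, (∀ l, y l ∈ I) →
      HasDerivAt (fun t => g (M (update y i t)))
        (deriv g (M y) * ((deriv f (M y))⁻¹ * V i y)) (y i) := fun hg y hy =>
    HasDerivAt.comp (y i) (by simpa using hder hg _ (hM y hy).1) (hMd i hpi y hy)
  have hVd : ∀ y : Fin n → ℝ, (∀ l, y l ∈ I) →
      HasDerivAt (fun t => V i (update y i t))
        (((deriv (p i) (y i) * deriv f (y i) + p i (y i) * deriv (deriv f) (y i)
          + (deriv (deriv (p i)) (y i) * (f (y i) - U y)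
            + deriv (p i) (y i) * (deriv f (y i) - V i y))) * D y
          - (p i (y i) * deriv f (y i) + deriv (p i) (y i) * (f (y i) - U y))
            * deriv (p i) (y i)) / D y ^ 2) (y i) := by
    intro y hy
    have hyi := hy i
    have h := (((hder hpi _ hyi).fun_mul (hder hfd2 _ hyi)).fun_add
      ((hder hpi2 _ hyi).fun_mul ((hder hfd _ hyi).fun_sub (hUd i hpi y hy)))).fun_div
      (hDd i hpi y hy) (by simpa using hD0 y hy)
    simpa [V] using h
  let K : (Fin n → ℝ) → ℝ := fun y => deriv (deriv f) (M y) * ((deriv f (M y))⁻¹ * V i y)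
  have hKd := fun y (hy : ∀ l, y l ∈ I) =>
    (hGd hfd3 y hy).fun_mul (((hGd hfd2 y hy).fun_inv
      (by simpa using hf' _ (hM y hy).1)).fun_mul (hVd y hy))
  let P1 : (Fin n → ℝ) → ℝ := fun y =>
    (p j (y j) * deriv f (y j) + deriv (p j) (y j) * (f (y j) - U y)) / (D y * deriv f (M y))
  let P2 : (Fin n → ℝ) → ℝ := fun y =>
    -(deriv (p j) (y j) * V i y) / (D y * deriv f (M y))
      - (p j (y j) * deriv f (y j) + deriv (p j) (y j) * (f (y j) - U y)) *
        (deriv (p i) (y i) / (D y ^ 2 * deriv f (M y)) + K y / (D y * deriv f (M y) ^ 2))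
  have h3 := fun y (hy : ∀ l, y l ∈ I) =>
    hasDerivAt_second_mixed (A := p j (y j) * deriv f (y j)) (B := deriv (p j) (y j))
      (c := f (y j)) (hUd i hpi y hy) (hDd i hpi y hy) (hGd hfd2 y hy) (hVd y hy)
      (hder hpi2 _ (hy i)) (hKd y hy) (by simpa using hD0 y hy)
      (by simpa using hf' _ (hM y hy).1)
  have hP2 : ∀ y t, P2 (update y i t) = -(deriv (p j) (y j) * V i (update y i t)) /
      (D (update y i t) * deriv f (M (update y i t)))
      - (p j (y j) * deriv f (y j) + deriv (p j) (y j) * (f (y j) - U (update y i t))) *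
        (deriv (p i) t / (D (update y i t) ^ 2 * deriv f (M (update y i t)))
          + K (update y i t) / (D (update y i t) * deriv f (M (update y i t)) ^ 2)) := by
    intro y t
    simp only [P2, update_of_ne hij.symm, update_self]
  refine ⟨P1, P2, fun y => deriv (fun t => P2 (update y i t)) (y i), ?_, ?_, ?_, ?_⟩
  · intro y hy
    convert hMd j hpj y hy using 1
    simp only [P1, V]
    have := hD0 y hy
    have := hf' _ (hM y hy).1
    field_simp
  · intro y hy
    have h := hasDerivAt_div_mul_comp (A := p j (y j) * deriv f (y j)) (B := deriv (p j) (y j))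
      (c := f (y j)) (hUd i hpi y hy) (hDd i hpi y hy) (hGd hfd2 y hy)
      (by simpa using hD0 y hy) (by simpa using hf' _ (hM y hy).1)
    simp only [update_eq_self] at h
    simpa only [P1, update_of_ne hij.symm] using h
  · intro y hy
    simp only [hP2]
    exact (h3 y hy).differentiableAt.hasDerivAt
  · intro x hx
    have hy : ∀ l, const (Fin n) x l ∈ I := fun _ => hx
    have hd := hD0 _ hy
    have hU : U (const (Fin n) x) = f x := by
      simp only [U, D, const_apply] at hd ⊢
      rw [← Finset.sum_mul, mul_div_cancel_left₀ _ hd]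
    have hMx : M (const (Fin n) x) = x := by
      rw [← hleft _ (hM _ hy).1, (hM _ hy).2, hU, hleft x hx]
    have hDx : D (const (Fin n) x) = ∑ l, p l x := rfl
    have hV : V i (const (Fin n) x) = p i x * deriv f x / ∑ l, p l x := by
      simp only [V, hU, hDx, const_apply, sub_self, mul_zero, add_zero]
    have hf0 := hf' x hx
    simp only [hP2]
    have h := (h3 _ hy).deriv
    simp only [update_eq_self] at h
    refine h.trans ?_
    simp only [hU, hMx, hV, const_apply, sub_self, mul_zero, add_zero]
    rw [hDx] at hd ⊢
    generalize (∑ l, p l x) = d at *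
    field_simp
    ring
end
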